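/- Let d > 0. There exists a nonzero test function φ with ∫_Ω ‖∇φ(x,y)‖² d(x,y) < (π²/(2d²))·∫_Ω |φ(x,y)|² d(x,y). (This expresses variationally that for α = 0 the pair Hamiltonian H₀ has an eigenvalue strictly below the bottom π²/(2d²) of its essential spectrum, i.e. its discrete spectrum is non-empty.) -/

import Mathlib

open Real Set MeasureTheory

/-- The configuration domain `Ω = {(x,y) : x ≥ 0, y ≥ 0, |x - y| ≤ d}`. -/
def pairDomain (d : ℝ) : Set (ℝ × ℝ) :=
  {p : ℝ × ℝ | 0 ≤ p.1 ∧ 0 ≤ p.2 ∧ |p.1 - p.2| ≤ d}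

/-- A test function: `C¹`, compactly supported, symmetric, vanishing on
`∂Ω_D = {(x,y) ∈ Ω : |x - y| = d}`. -/
def IsTestFunction (d : ℝ) (φ : ℝ × ℝ → ℝ) : Prop :=
  ContDiff ℝ 1 φ ∧ HasCompactSupport φ ∧
  (∀ x y : ℝ, φ (x, y) = φ (y, x)) ∧
  (∀ p : ℝ × ℝ, 0 ≤ p.1 → 0 ≤ p.2 → |p.1 - p.2| = d → φ p = 0)

/-! ### The positive part and its powers -/

lemma hasDerivAt_max_zero_sq (x : ℝ) :
    HasDerivAt (fun y : ℝ => max y 0 ^ 2) (2 * max x 0) x := by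
  have key : ∀ y : ℝ, y ≠ 0 → HasDerivAt (fun y : ℝ => max y 0 ^ 2) (2 * max y 0) y := by
    intro y hy
    rcases lt_or_gt_of_ne hy with h | h
    · rw [max_eq_right h.le, mul_zero]
      refine (hasDerivAt_const y (0 : ℝ)).congr_of_eventuallyEq ?_
      filter_upwards [gt_mem_nhds h] with z hz
      simp [max_eq_right (le_of_lt hz)]
    · rw [max_eq_left h.le]
      have h1 : HasDerivAt (fun z : ℝ => z ^ 2) (2 * y) y := by
        simpa using hasDerivAt_pow 2 y
      refine h1.congr_of_eventuallyEq ?_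
      filter_upwards [lt_mem_nhds h] with z hz
      simp [max_eq_left (le_of_lt hz)]
  by_cases hx : x = 0
  · subst hx
    exact hasDerivAt_of_hasDerivAt_of_ne (g := fun y : ℝ => 2 * max y 0) key
      (Continuous.continuousAt (by fun_prop)) (Continuous.continuousAt (by fun_prop))
  · exact key x hx

lemma contDiff_max_zero_sq : ContDiff ℝ 1 (fun y : ℝ => max y 0 ^ 2) := by
  refine contDiff_one_iff_deriv.2 ⟨fun x => (hasDerivAt_max_zero_sq x).differentiableAt, ?_⟩
  have : deriv (fun y : ℝ => max y 0 ^ 2) = fun x => 2 * max x 0 :=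
    funext fun x => (hasDerivAt_max_zero_sq x).deriv
  rw [this]
  fun_prop

lemma integral_sub_two_mul_pow (n : ℕ) (q b : ℝ) :
    ∫ y in (0 : ℝ)..b, (q - 2 * y) ^ n =
      (q ^ (n + 1) - (q - 2 * b) ^ (n + 1)) / (2 * (n + 1)) := by
  have hn : (n : ℝ) + 1 ≠ 0 := by positivity
  have hd : ∀ y ∈ Set.uIcc (0 : ℝ) b, HasDerivAt
      (fun y : ℝ => -((q - 2 * y) ^ (n + 1)) / (2 * (n + 1))) ((q - 2 * y) ^ n) y := by
    intro y _
    have h1 : HasDerivAt (fun y : ℝ => q - 2 * y) (-2) y := by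
      simpa using ((hasDerivAt_id y).const_mul 2).const_sub q
    have h2 := ((h1.fun_pow (n + 1)).fun_neg).div_const (2 * ((n : ℝ) + 1))
    refine h2.congr_deriv ?_
    rw [add_tsub_cancel_right]
    push_cast
    field_simp
  rw [intervalIntegral.integral_eq_sub_of_hasDerivAt hd
    (Continuous.intervalIntegrable (by fun_prop) _ _)]
  simp
  ring

lemma integral_max_sub_two_mul_pow {n : ℕ} (hn : n ≠ 0) {q Y : ℝ} (hq : 0 ≤ q)
    (hY : q ≤ 2 * Y) :
    ∫ y in (0 : ℝ)..Y, max (q - 2 * y) 0 ^ n = q ^ (n + 1) / (2 * (n + 1)) := by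
  rw [← intervalIntegral.integral_add_adjacent_intervals (b := q / 2)
    (Continuous.intervalIntegrable (by fun_prop) _ _)
    (Continuous.intervalIntegrable (by fun_prop) _ _)]
  have h1 : ∫ y in (0 : ℝ)..q / 2, max (q - 2 * y) 0 ^ n =
      ∫ y in (0 : ℝ)..q / 2, (q - 2 * y) ^ n := by
    refine intervalIntegral.integral_congr fun y hy => ?_
    rw [Set.uIcc_of_le (by positivity)] at hy
    rw [max_eq_left (by linarith [hy.2])]
  have h2 : ∫ y in (q / 2)..Y, max (q - 2 * y) 0 ^ n = ∫ y in (q / 2)..Y, (0 : ℝ) := by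
    refine intervalIntegral.integral_congr fun y hy => ?_
    rw [Set.uIcc_of_le (by linarith)] at hy
    rw [max_eq_right (by linarith [hy.1]), zero_pow hn]
  rw [h1, h2, integral_sub_two_mul_pow]
  simp [mul_div_cancel₀]

lemma integral_max_sub_pow {n : ℕ} (hn : n ≠ 0) :
    ∫ t in (0 : ℝ)..1, max (t - 3 / 4) 0 ^ n = (1 / 4) ^ (n + 1) / ((n : ℝ) + 1) := by
  rw [← intervalIntegral.integral_add_adjacent_intervals (b := 3 / 4)
    (Continuous.intervalIntegrable (by fun_prop) _ _)
    (Continuous.intervalIntegrable (by fun_prop) _ _)]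
  have h1 : ∫ t in (0 : ℝ)..3 / 4, max (t - 3 / 4) 0 ^ n = ∫ t in (0 : ℝ)..3 / 4, (0 : ℝ) := by
    refine intervalIntegral.integral_congr fun t ht => ?_
    rw [Set.uIcc_of_le (by norm_num)] at ht
    rw [max_eq_right (by linarith [ht.2]), zero_pow hn]
  have h2 : ∫ t in (3 / 4 : ℝ)..1, max (t - 3 / 4) 0 ^ n =
      ∫ t in (3 / 4 : ℝ)..1, (t - 3 / 4) ^ n := by
    refine intervalIntegral.integral_congr fun t ht => ?_
    rw [Set.uIcc_of_le (by norm_num)] at ht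
    rw [max_eq_left (by linarith [ht.1])]
  rw [h1, h2, intervalIntegral.integral_comp_sub_right (fun t => t ^ n), integral_pow]
  norm_num

/-! ### Integration over a neighbourhood of the corner -/

/-- The part of `pairDomain 1` at bounded distance from the corner. -/
def corner : Set (ℝ × ℝ) :=
  {p | p ∈ pairDomain 1 ∧ min p.1 p.2 ≤ 4 / 3}

lemma isCompact_corner : IsCompact corner := by
  have hc : IsClosed corner := by
    have h : corner = {p : ℝ × ℝ | 0 ≤ p.1} ∩ {p | 0 ≤ p.2} ∩ {p | |p.1 - p.2| ≤ 1} ∩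
        {p | min p.1 p.2 ≤ 4 / 3} := by
      ext p
      simp [corner, pairDomain, and_assoc]
    rw [h]
    refine ((IsClosed.inter ?_ ?_).inter ?_).inter ?_ <;>
      exact isClosed_le (by fun_prop) (by fun_prop)
  refine IsCompact.of_isClosed_subset (isCompact_Icc (a := ((0 : ℝ), (0 : ℝ))) (b := (3, 3)))
    hc ?_
  rintro ⟨x, y⟩ ⟨⟨hx, hy, hxy⟩, hm⟩
  simp only at hx hy hxy hm
  rw [abs_le] at hxy
  rcases min_le_iff.1 hm with h | h <;>
    exact ⟨⟨hx, hy⟩, ⟨by simp only; linarith, by simp only; linarith⟩⟩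

lemma setIntegral_slab {f : ℝ × ℝ → ℝ} (hf : Continuous f) {Y : ℝ} (hY : 0 ≤ Y)
    {J : ℝ → Set ℝ} (hJ : ∀ x, J x =ᵐ[volume] Ioc x (x + 1)) (hsub : ∀ x, J x ⊆ Icc x (x + 1))
    (hm : MeasurableSet {p : ℝ × ℝ | p.1 ∈ Icc 0 Y ∧ p.2 ∈ J p.1}) :
    ∫ p in {p : ℝ × ℝ | p.1 ∈ Icc 0 Y ∧ p.2 ∈ J p.1}, f p =
      ∫ x in (0 : ℝ)..Y, ∫ t in (0 : ℝ)..1, f (x, x + t) := by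
  set T : Set (ℝ × ℝ) := {p : ℝ × ℝ | p.1 ∈ Icc 0 Y ∧ p.2 ∈ J p.1} with hT
  have hint : IntegrableOn f T := by
    refine (hf.continuousOn.integrableOn_compact
      (isCompact_Icc (a := ((0 : ℝ), (0 : ℝ))) (b := (Y, Y + 1)))).mono_set ?_
    rintro ⟨x, y⟩ ⟨hx, hy⟩
    have := hsub _ hy
    simp only [mem_Icc] at hx this
    exact ⟨⟨hx.1, by simp only; linarith⟩, ⟨hx.2, by simp only; linarith⟩⟩
  rw [← integral_indicator hm, Measure.volume_eq_prod,
    integral_prod _ ((integrable_indicator_iff hm).2 hint),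
    intervalIntegral.integral_of_le hY, ← integral_Icc_eq_integral_Ioc,
    ← integral_indicator measurableSet_Icc]
  congr 1
  funext x
  by_cases hx : x ∈ Icc 0 Y
  · rw [indicator_of_mem hx]
    have h1 : ∀ y, T.indicator f (x, y) = (J x).indicator (fun y => f (x, y)) y := by
      intro y
      have : (x, y) ∈ T ↔ y ∈ J x := and_iff_right hx
      by_cases hy : y ∈ J x
      · rw [indicator_of_mem hy, indicator_of_mem (this.2 hy)]
      · rw [indicator_of_notMem hy, indicator_of_notMem (this.not.2 hy)]
    simp_rw [h1]
    rw [integral_congr_ae (indicator_ae_eq_of_ae_eq_set (hJ x)),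
      integral_indicator measurableSet_Ioc, ← intervalIntegral.integral_of_le (by linarith),
      intervalIntegral.integral_comp_add_left (fun y => f (x, y)) x, add_zero]
  · rw [indicator_of_notMem hx]
    have h1 : ∀ y, T.indicator f (x, y) = 0 := by
      intro y
      exact indicator_of_notMem (fun h => hx h.1) f
    simp_rw [h1]
    simp

lemma setIntegral_corner {f : ℝ × ℝ → ℝ} (hf : Continuous f)
    (hsymm : ∀ x y, f (x, y) = f (y, x)) :
    ∫ p in corner, f p =
      2 * ∫ t in (0 : ℝ)..1, ∫ y in (0 : ℝ)..4 / 3, f (y + t, y) := by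
  set A : Set (ℝ × ℝ) := {p : ℝ × ℝ | p.1 ∈ Icc 0 (4 / 3) ∧ p.2 ∈ Icc p.1 (p.1 + 1)} with hA
  set B : Set (ℝ × ℝ) := {p : ℝ × ℝ | p.1 ∈ Icc 0 (4 / 3) ∧ p.2 ∈ Ioc p.1 (p.1 + 1)} with hB
  have hAm : MeasurableSet A := by
    simp only [hA, mem_Icc]
    measurability
  have hBm : MeasurableSet B := by
    simp only [hB, mem_Icc, mem_Ioc]
    measurability
  have hunion : corner = A ∪ Prod.swap ⁻¹' B := by
    ext ⟨x, y⟩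
    simp only [corner, pairDomain, hA, hB, mem_ofPred_eq, mem_union, mem_preimage, Prod.swap,
      mem_Icc, mem_Ioc, abs_le, min_le_iff]
    constructor
    · rintro ⟨⟨hx, hy, h1, h2⟩, hm⟩
      rcases le_or_gt x y with h | h
      · left
        refine ⟨⟨hx, ?_⟩, h, by linarith⟩
        rcases hm with hm | hm <;> linarith
      · right
        refine ⟨⟨hy, ?_⟩, h, by linarith⟩
        rcases hm with hm | hm <;> linarith
    · rintro (⟨⟨h1, h2⟩, h3, h4⟩ | ⟨⟨h1, h2⟩, h3, h4⟩)
      · exact ⟨⟨h1, by linarith, by linarith, by linarith⟩, Or.inl h2⟩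
      · exact ⟨⟨by linarith, by linarith, by linarith, by linarith⟩, Or.inr h2⟩
  have hdisj : Disjoint A (Prod.swap ⁻¹' B) := by
    rw [Set.disjoint_left]
    rintro ⟨x, y⟩ h1 h2
    exact absurd h1.2.1 (not_le.2 h2.2.1)
  have hint : ∀ T ⊆ corner, IntegrableOn f T := fun T hT =>
    (hf.continuousOn.integrableOn_compact isCompact_corner).mono_set hT
  have hswap : ∫ p in Prod.swap ⁻¹' B, f p = ∫ p in B, f p := by
    have h := (Measure.measurePreserving_swap (μ := (volume : Measure ℝ))
      (ν := (volume : Measure ℝ))).setIntegral_preimage_emb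
      MeasurableEquiv.prodComm.measurableEmbedding f B
    rw [← Measure.volume_eq_prod] at h
    rw [← h]
    refine setIntegral_congr_fun (measurable_swap hBm) fun p _ => ?_
    exact hsymm p.1 p.2
  have hslab : ∫ x in (0 : ℝ)..4 / 3, ∫ t in (0 : ℝ)..1, f (x, x + t) =
      ∫ t in (0 : ℝ)..1, ∫ y in (0 : ℝ)..4 / 3, f (y + t, y) := by
    rw [intervalIntegral_intervalIntegral_swap]
    · simp_rw [hsymm]
    · have hc : Continuous (Function.uncurry fun x t : ℝ => f (x, x + t)) := by
        simp only [Function.uncurry_def]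
        fun_prop
      refine (hc.continuousOn.integrableOn_compact
        ((isCompact_uIcc (a := 0) (b := 4 / 3)).prod
          (isCompact_uIcc (a := 0) (b := 1)))).mono_set ?_
      exact prod_mono Set.uIoc_subset_uIcc Set.uIoc_subset_uIcc
  rw [hunion, setIntegral_union hdisj (measurable_swap hBm)
    (hint A (hunion ▸ subset_union_left)) (hint _ (hunion ▸ subset_union_right)), hswap, hA, hB,
    setIntegral_slab hf (by norm_num) (fun x => Ioc_ae_eq_Icc.symm) (fun x => Subset.rfl) hAm,
    setIntegral_slab hf (by norm_num) (fun x => Filter.EventuallyEq.rfl)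
      (fun x => Ioc_subset_Icc_self) hBm, hslab]
  ring

/-! ### The trial function -/

/-- The radial profile `(8/3 - a)₊² (8/3 + 2a)`, whose derivative is `-6a (8/3 - a)₊`. -/
noncomputable def profile (a : ℝ) : ℝ := max (8 / 3 - a) 0 ^ 2 * (8 / 3 + 2 * a)

/-- A `C¹` ramp rising from `0` at `3/4` to `1` at `1`. -/
noncomputable def ramp (τ : ℝ) : ℝ := 16 * max (τ - 3 / 4) 0 ^ 2

/-- For `0 < ε < 1` a smooth approximation of `|t|` taking the value `1` at `t = ±1`. -/
noncomputable def smoothAbs (ε t : ℝ) : ℝ := √((1 - ε ^ 2) * t ^ 2 + ε ^ 2)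

/-- The trial function, before cutting off far away from `pairDomain 1`. -/
noncomputable def trial (ε : ℝ) (p : ℝ × ℝ) : ℝ :=
  profile (p.1 + p.2 + smoothAbs ε (p.1 - p.2)) -
    profile (p.1 + p.2 + 1) * ramp (smoothAbs ε (p.1 - p.2))

/-- A pointwise bound for the partial derivatives of `trial` in the directions `x + y`
and `x - y`. -/
noncomputable def slopeBound (ε : ℝ) (p : ℝ × ℝ) : ℝ :=
  6 * (p.1 + p.2 + smoothAbs ε (p.1 - p.2)) *
      max (8 / 3 - (p.1 + p.2 + smoothAbs ε (p.1 - p.2))) 0 +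
    profile (p.1 + p.2 + 1) * (32 * max (smoothAbs ε (p.1 - p.2) - 3 / 4) 0)

lemma hasDerivAt_profile (a : ℝ) :
    HasDerivAt profile (-(6 * a * max (8 / 3 - a) 0)) a := by
  have h1 : HasDerivAt (fun a : ℝ => 8 / 3 - a) (-1) a := (hasDerivAt_id a).const_sub _
  have h2 : HasDerivAt (fun a : ℝ => max (8 / 3 - a) 0 ^ 2) (2 * max (8 / 3 - a) 0 * -1) a :=
    (hasDerivAt_max_zero_sq (8 / 3 - a)).comp a h1
  have h3 : HasDerivAt (fun a : ℝ => 8 / 3 + 2 * a) 2 a := by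
    simpa using ((hasDerivAt_id a).const_mul 2).const_add (8 / 3)
  refine (h2.mul h3).congr_deriv ?_
  rcases le_total (8 / 3 - a) 0 with h | h
  · simp [max_eq_right h]
  · rw [max_eq_left h]
    ring

lemma hasDerivAt_ramp (τ : ℝ) : HasDerivAt ramp (32 * max (τ - 3 / 4) 0) τ := by
  have h1 : HasDerivAt (fun τ : ℝ => τ - 3 / 4) 1 τ := (hasDerivAt_id τ).sub_const _
  refine (((hasDerivAt_max_zero_sq (τ - 3 / 4)).comp τ h1).const_mul 16).congr_deriv ?_
  ring

lemma contDiff_profile : ContDiff ℝ 1 profile :=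
  (contDiff_max_zero_sq.comp (contDiff_const.sub contDiff_id)).mul
    (contDiff_const.add (contDiff_const.mul contDiff_id))

lemma contDiff_ramp : ContDiff ℝ 1 ramp :=
  contDiff_const.mul (contDiff_max_zero_sq.comp (contDiff_id.sub contDiff_const))

lemma smoothAbs_radicand_pos {ε : ℝ} (h0 : 0 < ε) (h1 : ε < 1) (t : ℝ) :
    0 < (1 - ε ^ 2) * t ^ 2 + ε ^ 2 := by
  have : 0 < 1 - ε ^ 2 := by nlinarith
  positivity

lemma contDiff_smoothAbs {ε : ℝ} (h0 : 0 < ε) (h1 : ε < 1) :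
    ContDiff ℝ 1 (smoothAbs ε) :=
  ContDiff.sqrt (by fun_prop) fun t => (smoothAbs_radicand_pos h0 h1 t).ne'

lemma contDiff_trial {ε : ℝ} (h0 : 0 < ε) (h1 : ε < 1) : ContDiff ℝ 1 (trial ε) := by
  have hw : ContDiff ℝ 1 fun p : ℝ × ℝ => smoothAbs ε (p.1 - p.2) :=
    (contDiff_smoothAbs h0 h1).comp (contDiff_fst.sub contDiff_snd)
  have hs : ContDiff ℝ 1 fun p : ℝ × ℝ => p.1 + p.2 := contDiff_fst.add contDiff_snd
  exact (contDiff_profile.comp (hs.add hw)).sub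
    ((contDiff_profile.comp (hs.add contDiff_const)).mul (contDiff_ramp.comp hw))

lemma smoothAbs_nonneg (ε t : ℝ) : 0 ≤ smoothAbs ε t := Real.sqrt_nonneg _

lemma smoothAbs_neg (ε t : ℝ) : smoothAbs ε (-t) = smoothAbs ε t := by
  simp [smoothAbs]

lemma smoothAbs_of_abs_eq_one (ε : ℝ) {t : ℝ} (ht : |t| = 1) : smoothAbs ε t = 1 := by
  have : t ^ 2 = 1 := by rw [← sq_abs, ht, one_pow]
  simp [smoothAbs, this]

lemma smoothAbs_le_one {ε t : ℝ} (h0 : 0 < ε) (h1 : ε < 1) (ht : |t| ≤ 1) :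
    smoothAbs ε t ≤ 1 := by
  refine Real.sqrt_le_one.2 ?_
  have h2 : t ^ 2 ≤ 1 := (sq_le_one_iff_abs_le_one t).2 ht
  have h3 : 0 < 1 - ε ^ 2 := by nlinarith
  nlinarith

lemma exists_hasDerivAt_smoothAbs {ε : ℝ} (h0 : 0 < ε) (h1 : ε < 1) (t : ℝ) :
    ∃ c : ℝ, |c| ≤ 1 ∧ HasDerivAt (smoothAbs ε) c t := by
  have hpos := smoothAbs_radicand_pos h0 h1 t
  have hd : HasDerivAt (fun t : ℝ => (1 - ε ^ 2) * t ^ 2 + ε ^ 2)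
      ((1 - ε ^ 2) * (2 * t)) t := by
    simpa using ((hasDerivAt_pow 2 t).const_mul (1 - ε ^ 2)).add_const (ε ^ 2)
  refine ⟨_, ?_, hd.sqrt hpos.ne'⟩
  have h3 : 0 < 1 - ε ^ 2 := by nlinarith
  have hs : 0 < √((1 - ε ^ 2) * t ^ 2 + ε ^ 2) := Real.sqrt_pos.2 hpos
  rw [abs_div, div_le_one (by positivity), abs_of_pos (by positivity : 0 < 2 * √_)]
  have : |(1 - ε ^ 2) * t| ≤ √((1 - ε ^ 2) * t ^ 2 + ε ^ 2) := by
    refine Real.abs_le_sqrt ?_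
    have : (1 - ε ^ 2) * ((1 - ε ^ 2) * t ^ 2) ≤ 1 * ((1 - ε ^ 2) * t ^ 2) := by
      gcongr
      nlinarith
    nlinarith
  calc |(1 - ε ^ 2) * (2 * t)| = 2 * |(1 - ε ^ 2) * t| := by
        rw [← abs_two (α := ℝ), ← abs_mul, abs_two]
        congr 1
        ring
    _ ≤ _ := by gcongr

lemma profile_nonneg {a : ℝ} (ha : 0 ≤ a) : 0 ≤ profile a := by
  unfold profile
  positivity

lemma slopeBound_nonneg (ε : ℝ) {p : ℝ × ℝ} (hp : 0 ≤ p.1 + p.2) : 0 ≤ slopeBound ε p := by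
  have h1 := smoothAbs_nonneg ε (p.1 - p.2)
  have h2 : 0 ≤ profile (p.1 + p.2 + 1) := profile_nonneg (by linarith)
  unfold slopeBound
  positivity

lemma ramp_mul_le {s w : ℝ} (hs : 0 ≤ s) (h0 : 0 ≤ w) (h1 : w ≤ 1) :
    ramp w * (6 * (s + 1) * max (8 / 3 - (s + 1)) 0) ≤
      2 * (6 * (s + w) * max (8 / 3 - (s + w)) 0) := by
  rcases le_total w (3 / 4) with h | h
  · have : ramp w = 0 := by simp [ramp, max_eq_right (sub_nonpos.2 h)]
    rw [this, zero_mul]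
    positivity
  · have hr0 : 0 ≤ ramp w := by unfold ramp; positivity
    have hr : ramp w ≤ 1 := by
      rw [ramp, max_eq_left (sub_nonneg.2 h)]
      nlinarith
    calc ramp w * (6 * (s + 1) * max (8 / 3 - (s + 1)) 0)
        ≤ 1 * (6 * (2 * (s + w)) * max (8 / 3 - (s + w)) 0) := by
          gcongr
          linarith
      _ = _ := by ring

lemma norm_fderiv_trial_le {ε : ℝ} (h0 : 0 < ε) (h1 : ε < 1) {p : ℝ × ℝ}
    (hp : p ∈ pairDomain 1) : ‖fderiv ℝ (trial ε) p‖ ≤ 2 * slopeBound ε p := by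
  obtain ⟨hx, hy, hxy⟩ := hp
  obtain ⟨c, hc, hcd⟩ := exists_hasDerivAt_smoothAbs h0 h1 (p.1 - p.2)
  have hs : HasFDerivAt (fun q : ℝ × ℝ => q.1 + q.2)
      (ContinuousLinearMap.fst ℝ ℝ ℝ + ContinuousLinearMap.snd ℝ ℝ ℝ) p :=
    hasFDerivAt_fst.add hasFDerivAt_snd
  have ht : HasFDerivAt (fun q : ℝ × ℝ => q.1 - q.2)
      (ContinuousLinearMap.fst ℝ ℝ ℝ - ContinuousLinearMap.snd ℝ ℝ ℝ) p :=
    hasFDerivAt_fst.sub hasFDerivAt_snd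
  have hw := hcd.comp_hasFDerivAt p ht
  have hd := ((hasDerivAt_profile _).comp_hasFDerivAt p (hs.add hw)).sub
    (((hasDerivAt_profile _).comp_hasFDerivAt p (hs.add_const 1)).mul
      ((hasDerivAt_ramp _).comp_hasFDerivAt p hw))
  have hsl := slopeBound_nonneg ε (add_nonneg hx hy)
  have hd' : HasFDerivAt (trial ε) _ p := hd
  rw [hd'.fderiv]
  have hw0 := smoothAbs_nonneg ε (p.1 - p.2)
  have hw1 := smoothAbs_le_one h0 h1 hxy
  have hramp := ramp_mul_le (add_nonneg hx hy) hw0 hw1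
  have hg : 0 ≤ profile (p.1 + p.2 + 1) := profile_nonneg (by positivity)
  simp only [slopeBound] at hsl ⊢
  set w := smoothAbs ε (p.1 - p.2) with hwdef
  have hr0 : 0 ≤ ramp w := by unfold ramp; positivity
  set b₁ := 6 * (p.1 + p.2 + w) * max (8 / 3 - (p.1 + p.2 + w)) 0 with hb₁
  set b₂ := 6 * (p.1 + p.2 + 1) * max (8 / 3 - (p.1 + p.2 + 1)) 0 with hb₂
  set e := profile (p.1 + p.2 + 1) * (32 * max (w - 3 / 4) 0) with he
  have hb₁0 : 0 ≤ b₁ := by positivity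
  have hb₂0 : 0 ≤ b₂ := by positivity
  have he0 : 0 ≤ e := by positivity
  have hα : |-b₁ + ramp w * b₂| ≤ b₁ + e := by
    rw [abs_le]
    constructor <;> nlinarith
  have hβ : |c * (-b₁ - e)| ≤ b₁ + e := by
    rw [abs_mul, abs_of_nonpos (by linarith : -b₁ - e ≤ 0)]
    nlinarith [abs_nonneg c]
  refine ContinuousLinearMap.opNorm_le_bound _ (by positivity) fun v => ?_
  have hv : |v.1 + v.2| + |v.1 - v.2| ≤ 2 * ‖v‖ := by
    have h1 : |v.1| ≤ ‖v‖ := norm_fst_le v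
    have h2 : |v.2| ≤ ‖v‖ := norm_snd_le v
    rw [abs_le] at h1 h2
    rcases abs_cases (v.1 + v.2) with h | h <;> rcases abs_cases (v.1 - v.2) with h' | h' <;>
      linarith
  have heval : ∀ D : ℝ × ℝ →L[ℝ] ℝ, D v = (-b₁ + ramp w * b₂) * (v.1 + v.2) +
      c * (-b₁ - e) * (v.1 - v.2) → ‖D v‖ ≤ 2 * (b₁ + e) * ‖v‖ := by
    intro D hD
    rw [hD, Real.norm_eq_abs]
    calc _ ≤ |-b₁ + ramp w * b₂| * |v.1 + v.2| + |c * (-b₁ - e)| * |v.1 - v.2| := by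
          rw [← abs_mul, ← abs_mul]
          exact abs_add_le _ _
      _ ≤ (b₁ + e) * |v.1 + v.2| + (b₁ + e) * |v.1 - v.2| := by gcongr
      _ = (b₁ + e) * (|v.1 + v.2| + |v.1 - v.2|) := by ring
      _ ≤ (b₁ + e) * (2 * ‖v‖) := by gcongr
      _ = _ := by ring
  apply heval
  simp [← hwdef, hb₁, hb₂, he]
  ring

/-! ### The Rayleigh quotient of the limiting trial function -/

lemma integral_sum_mul_max_sub_two_mul_pow {n : ℕ} (a : Fin n → ℝ) {q Y : ℝ} (hq : 0 ≤ q)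
    (hY : q ≤ 2 * Y) :
    ∫ y in (0 : ℝ)..Y, ∑ i : Fin n, a i * max (q - 2 * y) 0 ^ ((i : ℕ) + 2) =
      ∑ i : Fin n, a i * (q ^ ((i : ℕ) + 3) / (2 * ((i : ℝ) + 3))) := by
  rw [intervalIntegral.integral_finsetSum fun i _ =>
    Continuous.intervalIntegrable (by fun_prop) _ _]
  refine Finset.sum_congr rfl fun i _ => ?_
  rw [intervalIntegral.integral_const_mul,
    integral_max_sub_two_mul_pow (by positivity) hq hY]
  push_cast
  ring

/-- Coefficients of the powers of `8/3 - 2t - 2y` in the energy density. -/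
noncomputable def outerCoeff (p : ℝ) : Fin 5 → ℝ :=
  ![-1024, 768, 32 * p - 144, -(16 * p), 2 * p]

/-- Coefficients of the powers of `5/3 - t - 2y` in the energy density, as functions of
`M = (t - 3/4)₊`. -/
noncomputable def innerCoeff (p M : ℝ) : Fin 5 → ℝ :=
  ![-7424 * M + 26624 * M ^ 2 - 60 * p * M ^ 2 + 12288 * M ^ 3 + 464 * p * M ^ 3
      - 832 * p * M ^ 4 - 256 * p * M ^ 5,
    -24768 * M - 31232 * M ^ 2 - 449 * p * M ^ 2 - 3072 * M ^ 3 + 1548 * p * M ^ 3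
      + 976 * p * M ^ 4 + 64 * p * M ^ 5,
    18944 * M - 256000 * M ^ 2 - 716 * p * M ^ 2 - 1184 * p * M ^ 3 + 8000 * p * M ^ 4,
    -3072 * M + 131072 * M ^ 2 + 464 * p * M ^ 2 + 192 * p * M ^ 3 - 4096 * p * M ^ 4,
    -16384 * M ^ 2 - 64 * p * M ^ 2 + 512 * p * M ^ 4]

/-- Coefficients of the powers of `(t - 3/4)₊` after integrating the energy density in `y`. -/
noncomputable def rampCoeff (p : ℝ) : Fin 11 → ℝ :=
  ![-240840457/116640,
    -11477895803/156764160 * p - 189803867/61236,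
    279178339/622080 * p + 69747337/1458,
    -1245005509/1959552 * p - 974288/9,
    -21548777/23328 * p + 7427720/81,
    713255/216 * p - 2192704/135,
    -2398639/810 * p - 14464,
    70934/135 * p + 10240/3,
    3224/7 * p + 8192/7,
    -320/3 * p,
    -256/7 * p]

lemma profile_eq (a : ℝ) : profile a = max (8 / 3 - a) 0 ^ 2 * (8 - 2 * max (8 / 3 - a) 0) := by
  rcases le_total (8 / 3 - a) 0 with h | h
  · simp [profile, max_eq_right h]
  · rw [profile, max_eq_left h]
    ring

lemma energy_density_eq (p : ℝ) {t : ℝ} (ht : t ∈ Icc (0 : ℝ) 1) (y : ℝ) :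
    p / 2 * trial 0 (y + t, y) ^ 2 - 4 * slopeBound 0 (y + t, y) ^ 2 =
      (∑ i : Fin 5, outerCoeff p i * max (8 / 3 - 2 * t - 2 * y) 0 ^ ((i : ℕ) + 2)) +
      ∑ i : Fin 5, innerCoeff p (max (t - 3 / 4) 0) i *
        max (5 / 3 - t - 2 * y) 0 ^ ((i : ℕ) + 2) := by
  have hw : smoothAbs 0 (y + t - y) = t := by
    simp [smoothAbs, Real.sqrt_sq ht.1]
  have h1 : 8 / 3 - (y + t + y + t) = 8 / 3 - 2 * t - 2 * y := by ring
  have h2 : 8 / 3 - (y + t + y + 1) = 5 / 3 - t - 2 * y := by ring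
  have hsl : (y + t + y + t) * max (8 / 3 - 2 * t - 2 * y) 0 =
      (8 / 3 - max (8 / 3 - 2 * t - 2 * y) 0) * max (8 / 3 - 2 * t - 2 * y) 0 := by
    rcases le_total (8 / 3 - 2 * t - 2 * y) 0 with h | h
    · simp [max_eq_right h]
    · rw [max_eq_left h]
      ring
  have hcases : max (t - 3 / 4) 0 = 0 ∨ max (5 / 3 - t - 2 * y) 0 = 0 ∨
      max (8 / 3 - 2 * t - 2 * y) 0 =
        max (5 / 3 - t - 2 * y) 0 + 1 / 4 - max (t - 3 / 4) 0 := by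
    rcases le_total (t - 3 / 4) 0 with h | h
    · exact Or.inl (max_eq_right h)
    rcases le_total (5 / 3 - t - 2 * y) 0 with h' | h'
    · exact Or.inr (Or.inl (max_eq_right h'))
    refine Or.inr (Or.inr ?_)
    rw [max_eq_left h, max_eq_left h', max_eq_left (by linarith [ht.2])]
    ring
  simp only [trial, slopeBound, hw, profile_eq, ramp, h1, h2, Fin.sum_univ_five, outerCoeff,
    innerCoeff]
  generalize max (8 / 3 - 2 * t - 2 * y) 0 = V at *
  generalize max (5 / 3 - t - 2 * y) 0 = Z at *
  generalize max (t - 3 / 4) 0 = M at *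
  have hsl' : 6 * (y + t + y + t) * V = 6 * ((8 / 3 - V) * V) := by
    rw [← hsl]
    ring
  rw [hsl']
  simp
  rcases hcases with h | h | h <;> rw [h] <;> ring

lemma integral_energy_density (p : ℝ) :
    ∫ t in (0 : ℝ)..1, ∫ y in (0 : ℝ)..4 / 3,
      (p / 2 * trial 0 (y + t, y) ^ 2 - 4 * slopeBound 0 (y + t, y) ^ 2) =
    14460826496015 / 529737449472 * p - 49706824625 / 188116992 := by
  have hinner : ∀ t ∈ Set.uIcc (0 : ℝ) 1, (∫ y in (0 : ℝ)..4 / 3,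
      (p / 2 * trial 0 (y + t, y) ^ 2 - 4 * slopeBound 0 (y + t, y) ^ 2)) =
      (∑ i : Fin 5, outerCoeff p i / (2 * ((i : ℝ) + 3)) * (8 / 3 - 2 * t) ^ ((i : ℕ) + 3)) +
      ∑ i : Fin 11, rampCoeff p i * max (t - 3 / 4) 0 ^ ((i : ℕ) + 1) := by
    intro t ht
    rw [Set.uIcc_of_le zero_le_one] at ht
    simp_rw [energy_density_eq p ht]
    rw [intervalIntegral.integral_add (Continuous.intervalIntegrable (by fun_prop) _ _)
        (Continuous.intervalIntegrable (by fun_prop) _ _),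
      integral_sum_mul_max_sub_two_mul_pow _ (by linarith [ht.2]) (by linarith [ht.1]),
      integral_sum_mul_max_sub_two_mul_pow _ (by linarith [ht.2]) (by linarith [ht.1])]
    congr 1
    · refine Finset.sum_congr rfl fun i _ => ?_
      ring
    · have hcases : max (t - 3 / 4) 0 = 0 ∨ 5 / 3 - t = 11 / 12 - max (t - 3 / 4) 0 := by
        rcases le_total (t - 3 / 4) 0 with h | h
        · exact Or.inl (max_eq_right h)
        · refine Or.inr ?_
          rw [max_eq_left h]
          ring
      simp only [Fin.sum_univ_succ, innerCoeff, rampCoeff]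
      generalize max (t - 3 / 4) 0 = M at *
      simp
      rcases hcases with h | h
      · rw [h]
        ring
      · rw [h]
        ring
  rw [intervalIntegral.integral_congr hinner,
    intervalIntegral.integral_add (Continuous.intervalIntegrable (by fun_prop) _ _)
      (Continuous.intervalIntegrable (by fun_prop) _ _),
    intervalIntegral.integral_finsetSum fun i _ =>
      Continuous.intervalIntegrable (by fun_prop) _ _,
    intervalIntegral.integral_finsetSum fun i _ =>
      Continuous.intervalIntegrable (by fun_prop) _ _]
  simp only [intervalIntegral.integral_const_mul, integral_sub_two_mul_pow,
    integral_max_sub_pow (Nat.succ_ne_zero _)]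
  simp only [Fin.sum_univ_succ, outerCoeff, rampCoeff]
  simp
  ring

lemma continuous_profile : Continuous profile := contDiff_profile.continuous

lemma continuous_energy_density (c : ℝ) : Continuous fun q : ℝ × (ℝ × ℝ) =>
    c * trial q.1 q.2 ^ 2 - 4 * slopeBound q.1 q.2 ^ 2 := by
  have := continuous_profile
  simp only [trial, slopeBound, ramp, smoothAbs]
  fun_prop

lemma trial_swap (ε x y : ℝ) : trial ε (x, y) = trial ε (y, x) := by
  simp only [trial, ← neg_sub x y, smoothAbs_neg, add_comm y x]

lemma slopeBound_swap (ε x y : ℝ) : slopeBound ε (x, y) = slopeBound ε (y, x) := by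
  simp only [slopeBound, ← neg_sub x y, smoothAbs_neg, add_comm y x]

lemma exists_setIntegral_energy_density_pos : ∃ ε ∈ Ioo (0 : ℝ) 1,
    0 < ∫ p in corner, (π ^ 2 / 2 * trial ε p ^ 2 - 4 * slopeBound ε p ^ 2) := by
  have hcont : Continuous fun ε : ℝ =>
      ∫ p in corner, (π ^ 2 / 2 * trial ε p ^ 2 - 4 * slopeBound ε p ^ 2) :=
    continuous_parametric_integral_of_continuous (continuous_energy_density (π ^ 2 / 2))
      isCompact_corner
  have hpos : 0 < ∫ p in corner, (π ^ 2 / 2 * trial 0 p ^ 2 - 4 * slopeBound 0 p ^ 2) := by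
    have hc : Continuous fun p : ℝ × ℝ => π ^ 2 / 2 * trial 0 p ^ 2 - 4 * slopeBound 0 p ^ 2 := by
      have h0 : Continuous fun p : ℝ × ℝ => ((0 : ℝ), p) := by fun_prop
      simpa only [Function.comp_def] using (continuous_energy_density (π ^ 2 / 2)).comp h0
    rw [setIntegral_corner hc fun x y => by rw [trial_swap, slopeBound_swap]]
    rw [integral_energy_density (π ^ 2)]
    nlinarith [Real.pi_gt_d2]
  have hev := (hcont.tendsto 0).eventually (lt_mem_nhds hpos)
  obtain ⟨ε, h, hε⟩ := ((hev.filter_mono nhdsWithin_le_nhds).and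
    (Ioo_mem_nhdsGT (zero_lt_one' ℝ))).exists
  exact ⟨ε, hε, h⟩

/-! ### Cutting off and scaling -/

/-- A bump function equal to `1` on `[-10, 10]` and vanishing outside `[-20, 20]`. -/
noncomputable def bump : ContDiffBump (0 : ℝ) := ⟨10, 20, by norm_num, by norm_num⟩

/-- A smooth compactly supported function equal to `1` near `corner`. -/
noncomputable def cutoff (p : ℝ × ℝ) : ℝ := bump p.1 * bump p.2

lemma contDiff_cutoff : ContDiff ℝ 1 cutoff :=
  ((ContDiffBump.contDiff _).comp contDiff_fst).mul
    ((ContDiffBump.contDiff _).comp contDiff_snd)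

lemma hasCompactSupport_cutoff : HasCompactSupport cutoff := by
  refine HasCompactSupport.intro
    ((isCompact_closedBall (0 : ℝ) 20).prod (isCompact_closedBall (0 : ℝ) 20)) fun p hp => ?_
  rcases not_and_or.1 hp with h | h
  · exact mul_eq_zero_of_left (ContDiffBump.zero_of_le_dist _ (not_le.1 h).le) _
  · exact mul_eq_zero_of_right _ (ContDiffBump.zero_of_le_dist _ (not_le.1 h).le)

lemma cutoff_eventuallyEq_one {p : ℝ × ℝ} (hp : p ∈ corner) : cutoff =ᶠ[nhds p] 1 := by
  have key : ∀ x : ℝ, 0 ≤ x → x ≤ 3 → ∀ᶠ z in nhds x, bump z = 1 := fun x h0 h3 =>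
    bump.eventuallyEq_one_of_mem_ball (by
      rw [Metric.mem_ball, Real.dist_0_eq_abs, abs_of_nonneg h0]
      exact h3.trans_lt (by norm_num [bump]))
  obtain ⟨⟨hx, hy, hxy⟩, hm⟩ := hp
  rw [abs_le] at hxy
  have h3 : p.1 ≤ 3 ∧ p.2 ≤ 3 := by
    rcases min_le_iff.1 hm with h | h <;> constructor <;> linarith
  filter_upwards [(continuous_fst.tendsto p).eventually (key p.1 hx h3.1),
    (continuous_snd.tendsto p).eventually (key p.2 hy h3.2)] with q h1 h2
  simp only [cutoff, Pi.one_apply]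
  rw [h1, h2, one_mul]

lemma trial_eventuallyEq_zero (ε : ℝ) {p : ℝ × ℝ} (hp : p ∈ pairDomain 1 \ corner) :
    trial ε =ᶠ[nhds p] 0 := by
  have hm : 4 / 3 < p.1 ∧ 4 / 3 < p.2 := lt_min_iff.1 (not_le.1 fun h => hp.2 ⟨hp.1, h⟩)
  have hz : ∀ a : ℝ, 8 / 3 ≤ a → profile a = 0 := fun a ha => by
    simp [profile, max_eq_right (sub_nonpos.2 ha)]
  have hs : ∀ᶠ q : ℝ × ℝ in nhds p, 8 / 3 < q.1 + q.2 :=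
    (continuous_fst.add continuous_snd).continuousAt.eventually (lt_mem_nhds (by
      simp only [Pi.add_apply]
      linarith [hm.1, hm.2]))
  filter_upwards [hs] with q hq
  have := smoothAbs_nonneg ε (q.1 - q.2)
  simp [trial, hz (q.1 + q.2 + smoothAbs ε (q.1 - q.2)) (by linarith),
    hz (q.1 + q.2 + 1) (by linarith)]

lemma isTestFunction_cutoff_mul_trial {ε : ℝ} (h0 : 0 < ε) (h1 : ε < 1) :
    IsTestFunction 1 (cutoff * trial ε) := by
  refine ⟨contDiff_cutoff.mul (contDiff_trial h0 h1), hasCompactSupport_cutoff.mul_right,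
    fun x y => ?_, fun p _ _ hp => ?_⟩
  · simp only [Pi.mul_apply, trial_swap ε x y, cutoff, mul_comm]
  · simp [trial, smoothAbs_of_abs_eq_one ε hp, ramp]
    norm_num

lemma measurableSet_pairDomain (d : ℝ) : MeasurableSet (pairDomain d) := by
  have h : pairDomain d = {p : ℝ × ℝ | 0 ≤ p.1} ∩ ({p | 0 ≤ p.2} ∩ {p | |p.1 - p.2| ≤ d}) := rfl
  rw [h]
  refine (IsClosed.inter ?_ (IsClosed.inter ?_ ?_)).measurableSet <;>
    exact isClosed_le (by fun_prop) (by fun_prop)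

lemma exists_isTestFunction_one : ∃ φ : ℝ × ℝ → ℝ, IsTestFunction 1 φ ∧
    ∫ p in pairDomain 1, ‖fderiv ℝ φ p‖ ^ 2 < π ^ 2 / 2 * ∫ p in pairDomain 1, φ p ^ 2 := by
  obtain ⟨ε, ⟨h0, h1⟩, hpos⟩ := exists_setIntegral_energy_density_pos
  have htest := isTestFunction_cutoff_mul_trial h0 h1
  refine ⟨cutoff * trial ε, htest, ?_⟩
  have hin : ∀ p ∈ corner, cutoff * trial ε =ᶠ[nhds p] trial ε := fun p hp => by
    filter_upwards [cutoff_eventuallyEq_one hp] with q hq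
    simp [hq]
  have hout : ∀ p ∈ pairDomain 1 \ corner, cutoff * trial ε =ᶠ[nhds p] fun _ => 0 :=
    fun p hp => by
      filter_upwards [trial_eventuallyEq_zero ε hp] with q hq
      simp [hq]
  have hsub : corner ⊆ pairDomain 1 := fun p hp => hp.1
  have hmeas := isCompact_corner.measurableSet
  have hgrad : ∫ p in pairDomain 1, ‖fderiv ℝ (cutoff * trial ε) p‖ ^ 2 =
      ∫ p in corner, ‖fderiv ℝ (cutoff * trial ε) p‖ ^ 2 :=
    setIntegral_eq_of_subset_of_forall_sdiff_eq_zero (measurableSet_pairDomain 1) hsub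
      fun p hp => by simp [(hout p hp).fderiv_eq]
  have hmass : ∫ p in pairDomain 1, (cutoff * trial ε) p ^ 2 = ∫ p in corner, trial ε p ^ 2 := by
    rw [setIntegral_eq_of_subset_of_forall_sdiff_eq_zero (measurableSet_pairDomain 1) hsub
      fun p hp => by rw [(hout p hp).eq_of_nhds]; simp]
    exact setIntegral_congr_fun hmeas fun p hp => by
      simp only [(hin p hp).eq_of_nhds]
  have hcd := (contDiff_trial h0 h1).continuous
  have hcs : Continuous fun p : ℝ × ℝ => 4 * slopeBound ε p ^ 2 := by
    have := continuous_profile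
    simp only [slopeBound, smoothAbs]
    fun_prop
  have hint : ∀ f : ℝ × ℝ → ℝ, Continuous f → IntegrableOn f corner := fun f hf =>
    hf.continuousOn.integrableOn_compact isCompact_corner
  rw [integral_sub (hint _ (by fun_prop)) (hint _ hcs), integral_const_mul, sub_pos] at hpos
  rw [hgrad, hmass]
  refine lt_of_le_of_lt (setIntegral_mono_on
    (hint _ ((htest.1.continuous_fderiv one_ne_zero).norm.pow 2)) (hint _ hcs) hmeas
    fun p hp => ?_) hpos
  rw [(hin p hp).fderiv_eq]
  calc _ ≤ (2 * slopeBound ε p) ^ 2 := by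
        gcongr
        exact norm_fderiv_trial_le h0 h1 (hsub hp)
    _ = _ := by ring

open scoped Pointwise in
lemma inv_smul_pairDomain {d : ℝ} (hd : 0 < d) :
    d⁻¹ • pairDomain d = pairDomain 1 := by
  ext ⟨x, y⟩
  rw [Set.mem_inv_smul_set_iff₀ hd.ne']
  simp only [pairDomain, mem_ofPred_eq, Prod.smul_mk, smul_eq_mul, ← mul_sub, abs_mul,
    abs_of_pos hd, mul_nonneg_iff_of_pos_left hd]
  rw [mul_le_iff_le_one_right hd]

lemma setIntegral_pairDomain_comp_smul (f : ℝ × ℝ → ℝ) {d : ℝ} (hd : 0 < d) :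
    ∫ p in pairDomain d, f (d⁻¹ • p) = d ^ 2 * ∫ p in pairDomain 1, f p := by
  rw [Measure.setIntegral_comp_smul_of_pos _ _ _ (inv_pos.2 hd),
    inv_smul_pairDomain hd]
  simp [Module.finrank_prod]

/-- there is a nonzero test function whose Rayleigh quotient lies
strictly below `π²/(2d²)`, the bottom of the essential spectrum of `H₀`:
variationally, the discrete spectrum of `H₀` is non-empty. -/
theorem discrete_spectrum_nonempty_alpha_zero (d : ℝ) (hd : 0 < d) :
    ∃ φ : ℝ × ℝ → ℝ, IsTestFunction d φ ∧
      0 < ∫ p in pairDomain d, (φ p) ^ 2 ∧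
      ∫ p in pairDomain d, ‖fderiv ℝ φ p‖ ^ 2 <
        (π ^ 2 / (2 * d ^ 2)) * ∫ p in pairDomain d, (φ p) ^ 2 := by
  obtain ⟨φ, ⟨hφ, hsupp, hsymm, hzero⟩, hlt⟩ := exists_isTestFunction_one
  have hd' : d⁻¹ ≠ 0 := inv_ne_zero hd.ne'
  have hmass : ∫ p in pairDomain d, φ (d⁻¹ • p) ^ 2 = d ^ 2 * ∫ p in pairDomain 1, φ p ^ 2 :=
    setIntegral_pairDomain_comp_smul (fun p => φ p ^ 2) hd
  have hgrad : ∫ p in pairDomain d, ‖fderiv ℝ (fun p => φ (d⁻¹ • p)) p‖ ^ 2 =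
      ∫ p in pairDomain 1, ‖fderiv ℝ φ p‖ ^ 2 := by
    simp only [fderiv_comp_smul, norm_smul, mul_pow, integral_const_mul, norm_inv,
      Real.norm_eq_abs, sq_abs, inv_pow]
    rw [setIntegral_pairDomain_comp_smul (fun p => ‖fderiv ℝ φ p‖ ^ 2) hd]
    field_simp
  have hpos : 0 < ∫ p in pairDomain 1, φ p ^ 2 :=
    pos_of_mul_pos_right ((integral_nonneg fun p => sq_nonneg _).trans_lt hlt) (by positivity)
  refine ⟨fun p => φ (d⁻¹ • p), ⟨by fun_prop, hsupp.comp_smul hd', fun x y => ?_,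
    fun p hx hy hp => ?_⟩, ?_, ?_⟩
  · simp only [Prod.smul_mk, hsymm]
  · refine hzero _ (by simpa using by positivity) (by simpa using by positivity) ?_
    simp only [Prod.smul_fst, Prod.smul_snd, smul_eq_mul, ← mul_sub, abs_mul, hp,
      abs_of_pos (inv_pos.2 hd)]
    exact inv_mul_cancel₀ hd.ne'
  · rw [hmass]
    positivity
  · rw [hmass, hgrad]
    convert hlt using 1
    field_simp
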